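/- For all nonnegative integers a, b, Σ_{k₁+…+k_{b+1} = a+b+2, k₁≥2, k_i≥1} ζ(k₁,…,k_{b+1}) = ζ(a+b+2) (the sum formula for multiple zeta values). -/

import Mathlib

/-- The multiple zeta value `ζ(k₁,…,k_r) = Σ_{m₁>…>m_r>0} Π 1/mᵢ^{kᵢ}`, as a sum over
strictly decreasing tuples of positive integers. -/
noncomputable def MZV {r : ℕ} (k : Fin r → ℕ) : ℝ :=
  ∑' m : {m : Fin r → ℕ // (∀ i, 0 < m i) ∧ ∀ i j : Fin r, i < j → m j < m i},
    ∏ i, (1 : ℝ) / ((m.1 i : ℝ) ^ (k i))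

open Finset Filter Topology
open scoped ENNReal Nat

/-- Strictly decreasing tuples of positive integers of length `r`. -/
abbrev DecTuple (r : ℕ) : Type :=
  {m : Fin r → ℕ // (∀ i, 0 < m i) ∧ ∀ i j : Fin r, i < j → m j < m i}

namespace DecTuple

/-- The largest entry of a decreasing tuple, `0` for the empty tuple. -/
def head : {r : ℕ} → DecTuple r → ℕ
  | 0, _ => 0
  | _ + 1, m => m.1 0

lemma le_head {r : ℕ} (m : DecTuple r) (i : Fin r) : m.1 i ≤ m.head := by
  cases r with
  | zero => exact i.elim0
  | succ r =>
    rcases Fin.eq_zero_or_eq_succ i with rfl | ⟨j, rfl⟩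
    · exact le_rfl
    · exact (m.2.2 _ _ (Fin.succ_pos j)).le

instance : Unique (DecTuple 0) where
  default := ⟨Fin.elim0, fun i => i.elim0, fun i => i.elim0⟩
  uniq _ := Subtype.ext (Subsingleton.elim _ _)

/-- Prepend the entry `head m + 1 + k` to a decreasing tuple `m`. -/
def cons {r : ℕ} (m : DecTuple r) (k : ℕ) : DecTuple (r + 1) :=
  ⟨Fin.cons (m.head + 1 + k) m.1, by
    refine ⟨fun i => ?_, fun i j hij => ?_⟩
    · refine Fin.cases ?_ (fun i => ?_) i
      · simp
      · simpa using m.2.1 i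
    · rcases Fin.eq_zero_or_eq_succ j with rfl | ⟨j, rfl⟩
      · exact absurd hij (Fin.not_lt_zero i)
      · rcases Fin.eq_zero_or_eq_succ i with rfl | ⟨i, rfl⟩
        · have := m.le_head j
          simp only [Fin.cons_zero, Fin.cons_succ]
          omega
        · simpa using m.2.2 i j (Fin.succ_lt_succ_iff.mp hij)⟩

/-- Remove the largest entry of a decreasing tuple. -/
def tail {r : ℕ} (m : DecTuple (r + 1)) : DecTuple r :=
  ⟨Fin.tail m.1, fun i => m.2.1 i.succ, fun i j hij =>
    m.2.2 i.succ j.succ (Fin.succ_lt_succ_iff.mpr hij)⟩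

lemma head_tail_lt {r : ℕ} (m : DecTuple (r + 1)) : m.tail.head < m.1 0 := by
  cases r with
  | zero => exact m.2.1 0
  | succ r => exact m.2.2 0 1 Fin.zero_lt_one

/-- A nonempty decreasing tuple is its tail together with the gap below its largest entry. -/
def consEquiv (r : ℕ) : DecTuple r × ℕ ≃ DecTuple (r + 1) where
  toFun p := p.1.cons p.2
  invFun m := (m.tail, m.1 0 - m.tail.head - 1)
  left_inv p := by
    have h : (p.1.cons p.2).tail = p.1 :=
      Subtype.ext (Fin.tail_cons (α := fun _ => ℕ) (p.1.head + 1 + p.2) p.1.1)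
    refine Prod.ext h ?_
    simp only [h]
    simp only [cons, Fin.cons_zero]
    omega
  right_inv m := by
    apply Subtype.ext
    have h := m.head_tail_lt
    have h' : m.tail.head + 1 + (m.1 0 - m.tail.head - 1) = m.1 0 := by omega
    simp only [cons, h']
    exact Fin.cons_self_tail m.1

lemma tsum_succ {r : ℕ} (F : DecTuple (r + 1) → ℝ≥0∞) :
    ∑' m, F m = ∑' (m : DecTuple r) (k : ℕ), F (m.cons k) := by
  rw [← (consEquiv r).tsum_eq, ENNReal.tsum_prod']
  rfl

end DecTuple

/-- The shifted factorial `(1 - x)(2 - x)⋯(n - x)`. -/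
noncomputable def shiftedFactorial (x : ℝ) (n : ℕ) : ℝ := ∏ j ∈ range n, ((j : ℝ) + 1 - x)

lemma shiftedFactorial_succ (x : ℝ) (n : ℕ) :
    shiftedFactorial x (n + 1) = shiftedFactorial x n * ((n : ℝ) + 1 - x) :=
  prod_range_succ _ _

lemma natCast_add_one_sub_pos {x : ℝ} (hx : x < 1) (n : ℕ) : 0 < (n : ℝ) + 1 - x := by
  have : (0 : ℝ) ≤ n := n.cast_nonneg
  linarith

lemma shiftedFactorial_pos {x : ℝ} (hx : x < 1) (n : ℕ) : 0 < shiftedFactorial x n :=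
  prod_pos fun j _ => natCast_add_one_sub_pos hx j

/-- The ratio `(1 - x)ₘ / (1 - x)ₘ₊ₙ` tends to `0` as `m → ∞` when `n` is positive. -/
lemma tendsto_shiftedFactorial_div {x : ℝ} (hx : x < 1) (n : ℕ) :
    Tendsto (fun m => shiftedFactorial x m / shiftedFactorial x (m + (n + 1))) atTop (𝓝 0) := by
  have h (m : ℕ) : shiftedFactorial x m / shiftedFactorial x (m + (n + 1)) =
      ∏ j ∈ range (n + 1), (((m + j : ℕ) : ℝ) + 1 - x)⁻¹ := by
    have h1 : shiftedFactorial x (m + (n + 1)) = shiftedFactorial x m *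
        ∏ j ∈ range (n + 1), (((m + j : ℕ) : ℝ) + 1 - x) := prod_range_add _ _ _
    rw [h1, prod_inv_distrib, div_mul_eq_div_div, div_self (shiftedFactorial_pos hx m).ne', one_div]
  simp_rw [h]
  have h0 : ∏ _j ∈ range (n + 1), (0 : ℝ) = 0 := by simp
  rw [← h0]
  refine tendsto_finsetProd _ fun j _ => tendsto_inv_atTop_zero.comp ?_
  refine tendsto_atTop_add_const_right _ (-x) (tendsto_atTop_add_const_right _ 1 ?_)
  exact tendsto_natCast_atTop_atTop.comp (tendsto_add_atTop_nat j)

/-- Telescoping sums of nonnegative terms. -/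
lemma tsum_ofReal_sub_succ {u v : ℕ → ℝ} (hv : ∀ k, 0 ≤ v k) (huv : ∀ k, v k = u k - u (k + 1))
    (hu : Tendsto u atTop (𝓝 0)) : ∑' k, ENNReal.ofReal (v k) = ENNReal.ofReal (u 0) := by
  have h : HasSum v (u 0) := by
    rw [hasSum_iff_tendsto_nat_of_nonneg hv]
    simp_rw [huv, sum_range_sub']
    simpa using hu.const_sub (u 0)
  rw [← ENNReal.ofReal_tsum_of_nonneg hv h.summable, h.tsum_eq]

/-- The connector `n! (1 - x)ₘ / (1 - x)ₘ₊ₙ`. -/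
noncomputable def connector (x : ℝ) (m n : ℕ) : ℝ :=
  n ! * (shiftedFactorial x m / shiftedFactorial x (m + n))

lemma connector_pos {x : ℝ} (hx : x < 1) (m n : ℕ) : 0 < connector x m n := by
  have h1 := shiftedFactorial_pos hx m
  have h2 := shiftedFactorial_pos hx (m + n)
  unfold connector
  positivity

lemma tsum_connector_left {x : ℝ} (hx : x < 1) (M n : ℕ) :
    ∑' k : ℕ, ENNReal.ofReal (1 / (((M + 1 + k : ℕ) : ℝ) - x)) *
        ENNReal.ofReal (connector x (M + 1 + k) (n + 1)) =
      ENNReal.ofReal (1 / ((n : ℝ) + 1)) * ENNReal.ofReal (connector x M (n + 1)) := by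
  have hpos (k : ℕ) : 0 < ((M + 1 + k : ℕ) : ℝ) - x := by
    have := natCast_add_one_sub_pos hx (M + k)
    push_cast at this ⊢
    linarith
  simp_rw [fun k => (ENNReal.ofReal_mul (p := 1 / (((M + 1 + k : ℕ) : ℝ) - x))
    (q := connector x (M + 1 + k) (n + 1)) (one_div_pos.mpr (hpos k)).le).symm]
  rw [← ENNReal.ofReal_mul (by positivity)]
  refine tsum_ofReal_sub_succ (u := fun k => 1 / ((n : ℝ) + 1) * connector x (M + k) (n + 1))
    (fun k => ?_) (fun k => ?_) ?_
  · have := hpos k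
    have := connector_pos hx (M + 1 + k) (n + 1)
    positivity
  · have h0 := natCast_add_one_sub_pos hx (M + k)
    have h1 := natCast_add_one_sub_pos hx (M + k + (n + 1))
    have h2 := shiftedFactorial_pos hx (M + k)
    have h3 := shiftedFactorial_pos hx (M + k + (n + 1))
    have e1 : M + 1 + k = M + k + 1 := by omega
    have e2 : M + k + 1 + (n + 1) = M + k + (n + 1) + 1 := by omega
    have hn : (n : ℝ) + 1 ≠ 0 := by positivity
    rw [← add_assoc M k 1, e1]
    unfold connector
    rw [e2, shiftedFactorial_succ x (M + k), shiftedFactorial_succ x (M + k + (n + 1))]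
    push_cast at h0 h1 ⊢
    have h0' := h0.ne'
    have h1' := h1.ne'
    field_simp
    ring
  · have h := ((tendsto_shiftedFactorial_div hx n).comp (tendsto_add_atTop_nat M)).const_mul
      (1 / ((n : ℝ) + 1) * (n + 1)!)
    rw [mul_zero] at h
    refine h.congr fun k => ?_
    simp only [Function.comp, connector, add_comm k M]
    ring

lemma tsum_connector_right {x : ℝ} (hx : x < 1) (m : ℕ) :
    ∑' n : ℕ, ENNReal.ofReal (shiftedFactorial x n / (n + 1)!) *
        ENNReal.ofReal (connector x (m + 1) (n + 1)) =
      ENNReal.ofReal (1 / ((m : ℝ) + 1)) := by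
  have hpos (n : ℕ) : 0 ≤ shiftedFactorial x n / (n + 1)! :=
    div_nonneg (shiftedFactorial_pos hx n).le (Nat.cast_nonneg _)
  simp_rw [fun n => (ENNReal.ofReal_mul (q := connector x (m + 1) (n + 1)) (hpos n)).symm]
  have hu0 : 1 / ((m : ℝ) + 1) = 1 / ((m : ℝ) + 1) *
      (shiftedFactorial x (m + 1) * (shiftedFactorial x 0 / shiftedFactorial x (0 + (m + 1)))) := by
    have := (shiftedFactorial_pos hx (m + 1)).ne'
    have h0 : shiftedFactorial x 0 = 1 := prod_range_zero _
    rw [zero_add, h0]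
    field_simp
  rw [hu0]
  refine tsum_ofReal_sub_succ (u := fun n => 1 / ((m : ℝ) + 1) *
    (shiftedFactorial x (m + 1) * (shiftedFactorial x n / shiftedFactorial x (n + (m + 1)))))
    (fun n => mul_nonneg (hpos n) (connector_pos hx _ _).le) (fun n => ?_) ?_
  · have h1 := (natCast_add_one_sub_pos hx (n + (m + 1))).ne'
    have h3 := (shiftedFactorial_pos hx (n + (m + 1))).ne'
    have e1 : m + 1 + (n + 1) = n + (m + 1) + 1 := by omega
    have e2 : n + 1 + (m + 1) = n + (m + 1) + 1 := by omega
    unfold connector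
    rw [e1, e2, shiftedFactorial_succ x n, shiftedFactorial_succ x (n + (m + 1))]
    push_cast at h1 ⊢
    have hf : ((n + 1)! : ℝ) ≠ 0 := by positivity
    field_simp
    ring
  · have h := ((tendsto_shiftedFactorial_div hx m).const_mul
      (shiftedFactorial x (m + 1))).const_mul (1 / ((m : ℝ) + 1))
    simpa only [mul_zero] using h

/-- Transporting all entries of a decreasing tuple through the connector. -/
lemma tsum_decTuple_connector {x : ℝ} (hx : x < 1) (r n : ℕ) :
    ∑' m : DecTuple r, (∏ i, ENNReal.ofReal (1 / ((m.1 i : ℝ) - x))) *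
        ENNReal.ofReal (connector x m.head (n + 1)) =
      ENNReal.ofReal (1 / ((n : ℝ) + 1)) ^ r * ENNReal.ofReal (connector x 0 (n + 1)) := by
  induction r with
  | zero =>
    rw [tsum_eq_single default fun m hm => absurd (Subsingleton.elim m default) hm]
    simp [DecTuple.head]
  | succ r ih =>
    rw [DecTuple.tsum_succ, pow_succ', mul_assoc, ← ih, ← ENNReal.tsum_mul_left]
    refine tsum_congr fun m => ?_
    rw [mul_left_comm, ← tsum_connector_left hx m.head n, ← ENNReal.tsum_mul_left]
    refine tsum_congr fun k => ?_
    rw [Fin.prod_univ_succ]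
    simp only [DecTuple.cons, DecTuple.head, Fin.cons_zero, Fin.cons_succ]
    ring

lemma tsum_decTuple_inv {x : ℝ} (hx : x < 1) (b : ℕ) :
    ∑' m : DecTuple (b + 1), ENNReal.ofReal (1 / (m.1 0 : ℝ)) *
        ∏ i, ENNReal.ofReal (1 / ((m.1 i : ℝ) - x)) =
      ∑' n : ℕ, ENNReal.ofReal (1 / ((n : ℝ) + 1)) ^ (b + 1) *
        ENNReal.ofReal (1 / ((n : ℝ) + 1 - x)) := by
  have h (m : DecTuple (b + 1)) : ENNReal.ofReal (1 / (m.1 0 : ℝ)) =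
      ∑' n : ℕ, ENNReal.ofReal (shiftedFactorial x n / (n + 1)!) *
        ENNReal.ofReal (connector x m.head (n + 1)) := by
    obtain ⟨k, hk⟩ : ∃ k, m.1 0 = k + 1 := ⟨m.1 0 - 1, by have := m.2.1 0; omega⟩
    have hh : m.head = k + 1 := hk
    rw [hk, hh, tsum_connector_right hx]
    push_cast
    rfl
  simp_rw [h, ← ENNReal.tsum_mul_right]
  rw [ENNReal.tsum_comm]
  refine tsum_congr fun n => ?_
  simp_rw [mul_assoc, mul_comm (ENNReal.ofReal (connector _ _ _))]
  rw [ENNReal.tsum_mul_left, tsum_decTuple_connector hx, mul_left_comm,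
    ← ENNReal.ofReal_mul (div_nonneg (shiftedFactorial_pos hx n).le (Nat.cast_nonneg _))]
  congr 2
  have h1 := (natCast_add_one_sub_pos hx n).ne'
  have h2 := (shiftedFactorial_pos hx n).ne'
  have h0 : shiftedFactorial x 0 = 1 := prod_range_zero _
  have hf : ((n + 1)! : ℝ) ≠ 0 := by positivity
  rw [connector, zero_add, shiftedFactorial_succ, h0]
  field_simp

lemma tsum_pi_prod_ennreal {r : ℕ} (f : Fin r → ℕ → ℝ≥0∞) :
    ∑' e : Fin r → ℕ, ∏ i, f i (e i) = ∏ i, ∑' n, f i n := by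
  induction r with
  | zero => simp [tsum_fintype]
  | succ r ih =>
    rw [Fin.prod_univ_succ, ← ih, ← (Fin.consEquiv fun _ : Fin (r + 1) => ℕ).tsum_eq,
      ENNReal.tsum_prod', ← ENNReal.tsum_mul_right]
    refine tsum_congr fun n => ?_
    rw [← ENNReal.tsum_mul_left]
    refine tsum_congr fun e => ?_
    simp [Fin.prod_univ_succ, Fin.consEquiv]

lemma tsum_geometric_shift {x : ℝ} (hx0 : 0 ≤ x) (hx : x < 1) {m : ℕ} (hm : 0 < m) :
    ∑' e : ℕ, ENNReal.ofReal x ^ e * ENNReal.ofReal (1 / (m : ℝ)) ^ (e + 1) =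
      ENNReal.ofReal (1 / ((m : ℝ) - x)) := by
  have hm' : (1 : ℝ) ≤ m := by exact_mod_cast hm
  have h0 : 0 ≤ x / m := by positivity
  have h1 : x / m < 1 := by rw [div_lt_one (by linarith)]; linarith
  have h (e : ℕ) : ENNReal.ofReal x ^ e * ENNReal.ofReal (1 / (m : ℝ)) ^ (e + 1) =
      ENNReal.ofReal (1 / (m : ℝ) * (x / m) ^ e) := by
    rw [← ENNReal.ofReal_pow hx0, ← ENNReal.ofReal_pow (by positivity),
      ← ENNReal.ofReal_mul (by positivity)]
    congr 1
    rw [div_pow, div_pow, one_pow, pow_succ]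
    field_simp
  simp_rw [h]
  rw [← ENNReal.ofReal_tsum_of_nonneg (fun e => by positivity)
    ((summable_geometric_of_lt_one h0 h1).mul_left _), tsum_mul_left,
    tsum_geometric_of_lt_one h0 h1]
  congr 1
  have : (m : ℝ) - x ≠ 0 := by linarith
  have : 1 - x / m ≠ 0 := by linarith
  field_simp

/-- Extended-nonnegative-real version of `MZV`. -/
noncomputable def eMZV {r : ℕ} (k : Fin r → ℕ) : ℝ≥0∞ :=
  ∑' m : DecTuple r, ∏ i, ENNReal.ofReal (1 / (m.1 i : ℝ)) ^ k i

lemma MZV_eq_toReal {r : ℕ} (k : Fin r → ℕ) : MZV k = (eMZV k).toReal := by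
  rw [eMZV, ENNReal.tsum_toReal_eq fun m => ENNReal.prod_ne_top fun i _ =>
    ENNReal.pow_ne_top ENNReal.ofReal_ne_top]
  refine tsum_congr fun m => ?_
  rw [ENNReal.toReal_prod]
  refine prod_congr rfl fun i _ => ?_
  rw [ENNReal.toReal_pow, ENNReal.toReal_ofReal (by positivity), one_div_pow]

/-- Admissible indices are obtained from arbitrary exponents by adding `(2, 1, …, 1)`. -/
lemma sum_admissible {M : Type*} [AddCommMonoid M] (a b : ℕ) (F : (Fin (b + 1) → ℕ) → M) :
    ∑ k ∈ (Finset.Nat.antidiagonalTuple (b + 1) (a + b + 2)).filter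
        (fun k => 2 ≤ k 0 ∧ ∀ i, 1 ≤ k i), F k =
      ∑ e ∈ Finset.Nat.antidiagonalTuple (b + 1) a, F (e + 1 + Pi.single 0 1) := by
  have hs : ∑ i : Fin (b + 1), (1 + Pi.single 0 1 : Fin (b + 1) → ℕ) i = b + 2 := by
    simp [sum_add_distrib]
  symm
  refine sum_bij (fun e _ => e + 1 + Pi.single 0 1) (fun e he => ?_) (fun e _ e' _ h => ?_)
    (fun k hk => ?_) (fun _ _ => rfl)
  · rw [Finset.Nat.mem_antidiagonalTuple] at he
    rw [mem_filter, Finset.Nat.mem_antidiagonalTuple]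
    refine ⟨?_, by simp, fun i => by simp; omega⟩
    simp only [add_assoc e, Pi.add_apply e, sum_add_distrib, he, hs]
    omega
  · simpa using h
  · rw [mem_filter, Finset.Nat.mem_antidiagonalTuple] at hk
    obtain ⟨h1, h2, h3⟩ := hk
    have he : (k - (1 + Pi.single 0 1)) + 1 + Pi.single 0 1 = k := by
      rw [add_assoc]
      refine tsub_add_cancel_of_le fun i => ?_
      rcases Fin.eq_zero_or_eq_succ i with rfl | ⟨j, rfl⟩
      · simpa using h2
      · simpa using h3 j.succ
    refine ⟨k - (1 + Pi.single 0 1), ?_, he⟩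
    rw [Finset.Nat.mem_antidiagonalTuple]
    have h4 := h1
    rw [← he] at h4
    simp only [add_assoc (k - _), Pi.add_apply (k - _), sum_add_distrib, hs] at h4
    omega

/-- The generating function of the left-hand sides of the sum formula. -/
lemma tsum_pow_mul_sum_eMZV {x : ℝ} (hx0 : 0 ≤ x) (hx : x < 1) (b : ℕ) :
    ∑' a : ℕ, ENNReal.ofReal x ^ a *
        ∑ e ∈ Finset.Nat.antidiagonalTuple (b + 1) a, eMZV (e + 1 + Pi.single 0 1) =
      ∑' m : DecTuple (b + 1), ENNReal.ofReal (1 / (m.1 0 : ℝ)) *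
        ∏ i, ENNReal.ofReal (1 / ((m.1 i : ℝ) - x)) := by
  have h (m : DecTuple (b + 1)) : ENNReal.ofReal (1 / (m.1 0 : ℝ)) *
      ∏ i, ENNReal.ofReal (1 / ((m.1 i : ℝ) - x)) =
      ∑' e : Fin (b + 1) → ℕ, ENNReal.ofReal x ^ (∑ i, e i) *
        ∏ i, ENNReal.ofReal (1 / (m.1 i : ℝ)) ^ (e + 1 + Pi.single 0 1 : Fin (b + 1) → ℕ) i := by
    simp_rw [fun i => (tsum_geometric_shift hx0 hx (m.2.1 i)).symm]
    rw [← tsum_pi_prod_ennreal, ← ENNReal.tsum_mul_left]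
    refine tsum_congr fun e => ?_
    simp only [Pi.add_apply, Pi.one_apply, pow_add _ (e _ + 1), prod_mul_distrib,
      prod_pow_eq_pow_sum]
    have h1 : ∏ i, ENNReal.ofReal (1 / (m.1 i : ℝ)) ^ (Pi.single 0 1 : Fin (b + 1) → ℕ) i =
        ENNReal.ofReal (1 / (m.1 0 : ℝ)) := by
      rw [Fin.prod_univ_succ]
      simp
    rw [h1]
    ring
  simp_rw [h]
  rw [ENNReal.tsum_comm, ← (Finset.Nat.sigmaAntidiagonalTupleEquivTuple (b + 1)).tsum_eq,
    ENNReal.tsum_sigma']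
  refine tsum_congr fun a => ?_
  rw [mul_sum, ← Finset.tsum_subtype]
  refine tsum_congr fun e => ?_
  have he := Finset.Nat.mem_antidiagonalTuple.mp e.2
  simp only [Finset.Nat.sigmaAntidiagonalTupleEquivTuple_apply, he]
  rw [ENNReal.tsum_mul_left]
  rfl

lemma eMZV_one (s : ℕ) :
    eMZV (fun _ : Fin 1 => s) = ∑' n : ℕ, ENNReal.ofReal (1 / ((n : ℝ) + 1)) ^ s := by
  rw [eMZV, DecTuple.tsum_succ,
    tsum_eq_single default fun m hm => absurd (Subsingleton.elim m default) hm]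
  refine tsum_congr fun n => ?_
  simp [DecTuple.cons, DecTuple.head, add_comm]

/-- The generating function of the right-hand sides of the sum formula. -/
lemma tsum_pow_mul_eMZV_one {x : ℝ} (hx0 : 0 ≤ x) (hx : x < 1) (b : ℕ) :
    ∑' a : ℕ, ENNReal.ofReal x ^ a * eMZV (fun _ : Fin 1 => a + b + 2) =
      ∑' n : ℕ, ENNReal.ofReal (1 / ((n : ℝ) + 1)) ^ (b + 1) *
        ENNReal.ofReal (1 / ((n : ℝ) + 1 - x)) := by
  simp_rw [eMZV_one, ← ENNReal.tsum_mul_left]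
  rw [ENNReal.tsum_comm]
  refine tsum_congr fun n => ?_
  have h := tsum_geometric_shift hx0 hx n.succ_pos
  push_cast at h
  rw [← h, ← ENNReal.tsum_mul_left]
  refine tsum_congr fun a => ?_
  ring

lemma eMZV_one_le (s : ℕ) :
    eMZV (fun _ : Fin 1 => s + 2) ≤ eMZV (fun _ : Fin 1 => 2) := by
  simp_rw [eMZV_one]
  refine ENNReal.tsum_le_tsum fun n => pow_le_pow_of_le_one zero_le ?_ (by omega)
  rw [ENNReal.ofReal_le_one, div_le_one (by positivity)]
  linarith [n.cast_nonneg (α := ℝ)]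

lemma eMZV_two_ne_top : eMZV (fun _ : Fin 1 => 2) ≠ ∞ := by
  have h := (summable_nat_add_iff 1).mpr (Real.summable_one_div_nat_pow.mpr one_lt_two)
  rw [eMZV_one]
  simp_rw [fun n : ℕ => (ENNReal.ofReal_pow (p := 1 / ((n : ℝ) + 1)) (by positivity) 2).symm]
  have h' : Summable fun n : ℕ => (1 / ((n : ℝ) + 1)) ^ 2 := by simpa using h
  exact h'.tsum_ofReal_ne_top

/-- A power series with nonnegative coefficients is determined by its values on `[0, 1)`, provided
these are finite. -/
lemma eq_of_tsum_pow_mul_eq {c d : ℕ → ℝ≥0∞}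
    (h : ∀ x : ℝ, 0 ≤ x → x < 1 →
      ∑' a, ENNReal.ofReal x ^ a * c a = ∑' a, ENNReal.ofReal x ^ a * d a)
    (hd : ∀ x : ℝ, 0 ≤ x → x < 1 → ∑' a, ENNReal.ofReal x ^ a * d a ≠ ∞) : c = d := by
  have key (c : ℕ → ℝ≥0∞)
      (hc : ∀ x : ℝ, 0 ≤ x → x < 1 → ∑' a, ENNReal.ofReal x ^ a * c a ≠ ∞) :
      (∀ a, c a ≠ ∞) ∧ ∀ x : ℝ, 0 ≤ x → x < 1 → HasSum (fun a => x ^ a * (c a).toReal)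
        (∑' a, ENNReal.ofReal x ^ a * c a).toReal := by
    refine ⟨fun a ha => ?_, fun x hx0 hx => ?_⟩
    · refine ENNReal.ne_top_of_tsum_ne_top (hc (1 / 2) (by norm_num) (by norm_num)) a ?_
      rw [ha, ENNReal.mul_top]
      exact pow_ne_zero _ (by norm_num)
    · have h := ENNReal.hasSum_toReal (hc x hx0 hx)
      rw [← ENNReal.tsum_toReal_eq (ENNReal.ne_top_of_tsum_ne_top (hc x hx0 hx))] at h
      refine h.congr_fun fun a => ?_
      simp [ENNReal.toReal_ofReal hx0]
  obtain ⟨hct, hcs⟩ := key c fun x hx0 hx => (h x hx0 hx).trans_ne (hd x hx0 hx)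
  obtain ⟨hdt, hds⟩ := key d hd
  set g : ℕ → ℝ := fun a => (c a).toReal - (d a).toReal with hg
  have hgs (x : ℝ) (hx0 : 0 ≤ x) (hx : x < 1) : HasSum (fun a => x ^ a * g a) 0 := by
    have := (hcs x hx0 hx).sub (hds x hx0 hx)
    rw [h x hx0 hx, sub_self] at this
    simpa only [hg, mul_sub] using this
  have hp : HasFPowerSeriesAt (fun x : ℝ => ∑' a, x ^ a * g a)
      (FormalMultilinearSeries.ofScalars ℝ g) 0 := by
    rw [hasFPowerSeriesAt_iff]
    filter_upwards [Metric.ball_mem_nhds (0 : ℝ) one_pos] with x hx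
    rw [mem_ball_zero_iff, Real.norm_eq_abs] at hx
    simp only [FormalMultilinearSeries.coeff_ofScalars, smul_eq_mul, zero_add]
    refine Summable.hasSum (Summable.of_norm ?_)
    simpa [abs_mul] using (hgs |x| (abs_nonneg x) hx).summable.norm
  have hp0 : FormalMultilinearSeries.ofScalars ℝ g = 0 := by
    by_contra hne
    have h1 := (hp.locally_ne_zero hne).filter_mono
      (nhdsWithin_mono 0 fun x (hx : x ∈ Set.Ioi (0 : ℝ)) => ne_of_gt hx)
    have h2 : Set.Ioo (0 : ℝ) 1 ∈ 𝓝[>] 0 := Ioo_mem_nhdsGT one_pos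
    obtain ⟨x, hx, hx'⟩ := (h1.and h2).exists
    exact hx (hgs x hx'.1.le hx'.2).tsum_eq
  funext a
  have hga : g a = 0 := by
    rw [← FormalMultilinearSeries.coeff_ofScalars (𝕜 := ℝ) (p := g) (n := a), hp0]
    rfl
  exact (ENNReal.toReal_eq_toReal_iff' (hct a) (hdt a)).mp (sub_eq_zero.mp hga)

/-- The sum formula in the extended nonnegative reals. -/
lemma sum_eMZV (a b : ℕ) :
    ∑ e ∈ Finset.Nat.antidiagonalTuple (b + 1) a, eMZV (e + 1 + Pi.single 0 1) =
      eMZV (fun _ : Fin 1 => a + b + 2) := by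
  suffices h : (fun a => ∑ e ∈ Finset.Nat.antidiagonalTuple (b + 1) a,
      eMZV (e + 1 + Pi.single 0 1)) = fun a => eMZV (fun _ : Fin 1 => a + b + 2) from
    congrFun h a
  refine eq_of_tsum_pow_mul_eq (fun x hx0 hx => ?_) fun x hx0 hx => ?_
  · rw [tsum_pow_mul_sum_eMZV hx0 hx, tsum_decTuple_inv hx, tsum_pow_mul_eMZV_one hx0 hx]
  · refine ne_top_of_le_ne_top ?_
      (ENNReal.tsum_le_tsum fun a => mul_le_mul_right (eMZV_one_le (a + b)) _)
    rw [ENNReal.tsum_mul_right, ENNReal.tsum_geometric]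
    refine ENNReal.mul_ne_top (ENNReal.inv_ne_top.mpr ?_) eMZV_two_ne_top
    exact (tsub_pos_of_lt (ENNReal.ofReal_lt_one.mpr hx)).ne'

/-- The sum formula for multiple zeta values: for all `a, b ≥ 0`,
`Σ_{k₁+…+k_{b+1}=a+b+2, k₁≥2, kᵢ≥1} ζ(k₁,…,k_{b+1}) = ζ(a+b+2)`. -/
theorem mzv_sum_formula (a b : ℕ) :
    ∑ k ∈ (Finset.Nat.antidiagonalTuple (b + 1) (a + b + 2)).filter
        (fun k => 2 ≤ k 0 ∧ ∀ i, 1 ≤ k i),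
      MZV k = MZV (fun _ : Fin 1 => a + b + 2) := by
  have hfin : eMZV (fun _ : Fin 1 => a + b + 2) ≠ ∞ :=
    ne_top_of_le_ne_top eMZV_two_ne_top (eMZV_one_le (a + b))
  rw [sum_admissible, MZV_eq_toReal, ← sum_eMZV, ENNReal.toReal_sum]
  · exact sum_congr rfl fun e _ => MZV_eq_toReal _
  · rw [← sum_eMZV] at hfin
    exact fun e he => ne_top_of_le_ne_top hfin
      (single_le_sum (f := fun e => eMZV (e + 1 + Pi.single 0 1)) (fun _ _ => zero_le) he)
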